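/- Let δ ∈ (0, δ_max]. Set Ê_max(δ) = Ĥ_CP(0, 0; δ) and Ê_min(δ) = Ĥ_CP(0.49, π; δ). Then Ê_min(δ) < Ê_max(δ), and for every Ê ∈ [Ê_min(δ), Ê_max(δ)] there exist T̂ > 0 and continuously differentiable functions Γ̂, ĥ : ℝ → ℝ solving the rescaled coplanar system, such that ĥ(0) = 0, Γ̂(t) ∈ [0, 0.49] for all t ∈ ℝ, Ĥ_CP(Γ̂(t), ĥ(t); δ) = Ê for all t ∈ ℝ, and Γ̂(t+T̂) = Γ̂(t), ĥ(t+T̂) = ĥ(t) − 2π for all t ∈ ℝ. -/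

import Mathlib

noncomputable section
open Real Set

namespace Secular

def U00 : ℝ := 0.762646
def U10 : ℝ := 0.547442
def U20 : ℝ := 0.237353
def mC : ℝ := (-4 + Real.sqrt 21) / 5
def rhoC : ℝ := 1.762157978551987e-18
def muC : ℝ := 398600.44
def aM : ℝ := 384400
def aMin : ℝ := 6378.14
def aMax : ℝ := 30000
def Lmin : ℝ := Real.sqrt (muC * aMin)
def Lmax : ℝ := Real.sqrt (muC * aMax)
def deltaFun (L : ℝ) : ℝ := rhoC * L ^ 10 / (muC ^ 3 * aM ^ 3)
def deltaMax : ℝ := deltaFun Lmax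
def rho0 : ℝ := muC ^ 4 * 1.08e-3 * 6378.14 ^ 2
def rho1 : ℝ := rhoC * rho0
def alphaCube (L : ℝ) : ℝ := L ^ 6 / (muC ^ 3 * aM ^ 3)

def aA (σ : ℝ) : ℝ := 1 - 16 * σ - 20 * σ ^ 2
def bB (σ : ℝ) : ℝ := (2 * σ + 3) * Real.sqrt (3 - 4 * σ - 4 * σ ^ 2)
def cPl (σ : ℝ) : ℝ := U00 / 2 * aA σ + 5 * U10 / 3 * bB σ
def cMi (σ : ℝ) : ℝ := U00 / 2 * aA σ - 5 * U10 / 3 * bB σ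
def Ap (σ δ : ℝ) : ℝ := aA σ + δ * cPl σ
def Am (σ δ : ℝ) : ℝ := aA σ + δ * cMi σ


/-- Rescaled coplanar secular Hamiltonian at circular motions `ξ = η = 0`. -/
def HCPhat (Γh h δ : ℝ) : ℝ :=
  (1 - 12*Γh - 12*Γh^2) * (1 + δ * U00 / 2)
  - 2 * δ * U10 * (2*Γh + 1) * Real.sqrt ((1 - 2*Γh) * (3 + 2*Γh)) * Real.cos h
  - (δ * U20 / 2) * (1 - 2*Γh) * (3 + 2*Γh) * Real.cos (2*h)

/-- RHS of `ĥ'` in the rescaled coplanar system. -/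
def Fh (Γh h δ : ℝ) : ℝ :=
  -(1 + 2*Γh) * (1 + δ * U00 / 2)
  - (2*δ/3) * U10 * (1 - 4*Γh - 4*Γh^2) / Real.sqrt ((1 - 2*Γh) * (3 + 2*Γh)) * Real.cos h
  + (δ/6) * U20 * (1 + 2*Γh) * Real.cos (2*h)

/-- RHS of `Γ̂'` in the rescaled coplanar system. -/
def FΓ (Γh h δ : ℝ) : ℝ :=
  -(δ/12) * (2 * U10 * Real.sqrt ((1 - 2*Γh) * (3 + 2*Γh)) * (2*Γh + 1) * Real.sin h
    + U20 * (1 - 2*Γh) * (3 + 2*Γh) * Real.sin (2*h))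

/-- `(Γ̂, ĥ)` solves the rescaled coplanar system on `ℝ`. -/
def SolvesCP (Γh hh : ℝ → ℝ) (δ : ℝ) : Prop :=
  ∀ t : ℝ, HasDerivAt Γh (FΓ (Γh t) (hh t) δ) t ∧ HasDerivAt hh (Fh (Γh t) (hh t) δ) t

/-- A function whose graph lies in a level set of `H`, and which selects the only point of that
level set in `U` above each `y`, is differentiable wherever `∂H/∂z ≠ 0`. -/
theorem hasDerivAt_of_levelSet {H : ℝ × ℝ → ℝ} {H' : ℝ × ℝ →L[ℝ] ℝ} {g : ℝ → ℝ} {x E : ℝ}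
    {U : Set ℝ} (hU : U ∈ nhds (g x)) (hinj : ∀ y, Set.InjOn (fun z => H (y, z)) U)
    (hgU : ∀ y, g y ∈ U) (hgE : ∀ y, H (y, g y) = E)
    (dH : HasStrictFDerivAt H H' (x, g x)) (hb : H' (0, 1) ≠ 0) :
    HasDerivAt g (-H' (1, 0) / H' (0, 1)) x := by
  have hinv : (H' ∘L ContinuousLinearMap.inr ℝ ℝ ℝ).IsInvertible := by
    refine ⟨ContinuousLinearEquiv.unitsEquivAut ℝ (Units.mk0 _ hb), ?_⟩
    ext
    simp
  have hev : dH.implicitFunctionOfProdDomain hinv =ᶠ[nhds x] g := by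
    filter_upwards [(dH.tendsto_implicitFunctionOfProdDomain hinv).eventually_mem hU,
      dH.eventually_apply_implicitFunctionOfProdDomain hinv] with y hyU hyE
    exact hinj y hyU (hgU y) (hyE.trans ((hgE x).trans (hgE y).symm))
  have hd : DifferentiableAt ℝ g x :=
    ((dH.hasStrictFDerivAt_implicitFunctionOfProdDomain hinv).hasFDerivAt.differentiableAt
      ).congr_of_eventuallyEq hev.symm
  have hc : HasDerivAt (fun y => H (y, g y)) (H' (1, deriv g x)) x :=
    dH.hasFDerivAt.comp_hasDerivAt x ((hasDerivAt_id x).prodMk hd.hasDerivAt)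
  have h0 : H' (1, deriv g x) = 0 := by
    have : (fun y => H (y, g y)) = fun _ => E := funext hgE
    rw [this] at hc
    exact hc.unique (hasDerivAt_const x E)
  have hlin : H' (1, deriv g x) = H' (1, 0) + deriv g x * H' (0, 1) := by
    rw [← smul_eq_mul, ← map_smul, ← map_add]
    simp
  have hval : deriv g x = -H' (1, 0) / H' (0, 1) := by
    rw [eq_div_iff hb]
    linarith
  exact hval ▸ hd.hasDerivAt

/-- A negative continuous periodic scalar field has a global solution that decreases by one
period of the field in finite time. -/
theorem exists_solution_of_periodic_neg {f : ℝ → ℝ} {P : ℝ} (hf : Continuous f)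
    (hneg : ∀ x, f x < 0) (hper : Function.Periodic f P) (hP : 0 < P) :
    ∃ T > 0, ∃ θ : ℝ → ℝ, θ 0 = 0 ∧ (∀ t, HasDerivAt θ (f (θ t)) t) ∧
      ∀ t, θ (t + T) = θ t - P := by
  set k : ℝ → ℝ := fun x => -(f x)⁻¹ with hk
  have hkc : Continuous k := (hf.inv₀ fun x => (hneg x).ne).neg
  have hkpos : ∀ x, 0 < k x := fun x => neg_pos.2 (inv_lt_zero.2 (hneg x))
  have hkper : Function.Periodic k P := fun x => by simp only [hk, hper x]
  have hki : ∀ a b, IntervalIntegrable k MeasureTheory.volume a b := hkc.intervalIntegrable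
  set τ : ℝ → ℝ := fun x => ∫ y in (0 : ℝ)..x, k y with hτ
  have hτd : ∀ x, HasDerivAt τ (k x) x := fun x => hkc.integral_hasStrictDerivAt 0 x |>.hasDerivAt
  have hτmono : StrictMono τ := strictMono_of_hasDerivAt_pos hτd hkpos
  have hτsurj : Function.Surjective τ :=
    (continuous_iff_continuousAt.2 fun x => (hτd x).continuousAt).surjective
      (hkper.tendsto_atTop_intervalIntegral_of_pos' (hki _ _) hkpos hP)
      (hkper.tendsto_atBot_intervalIntegral_of_pos' (hki _ _) hkpos hP)
  have hτper : ∀ x, τ (x + P) = τ x + τ P := fun x => by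
    have h1 := intervalIntegral.integral_add_adjacent_intervals (hki 0 x) (hki x (x + P))
    have h2 := hkper.intervalIntegral_add_eq x 0
    rw [zero_add] at h2
    linarith
  have hτ0 : τ 0 = 0 := intervalIntegral.integral_same
  let e : ℝ ≃o ℝ := hτmono.orderIsoOfSurjective τ hτsurj
  have hes : ∀ t, τ (e.symm t) = t := fun t => e.apply_symm_apply t
  have hed : ∀ t, HasDerivAt e.symm (k (e.symm t))⁻¹ t := fun t =>
    (hτd _).of_local_left_inverse e.symm.continuous.continuousAt (hkpos _).ne'
      (Filter.Eventually.of_forall hes)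
  refine ⟨τ P, hτ0 ▸ hτmono hP, fun t => e.symm (-t), ?_, fun t => ?_, fun t => ?_⟩
  · exact hτmono.injective (by rw [hes, hτ0, neg_zero])
  · refine ((hed (-t)).scomp t (hasDerivAt_neg t)).congr_deriv ?_
    simp [hk]
  · refine hτmono.injective ?_
    have h := hτper (e.symm (-t) - P)
    rw [sub_add_cancel, hes] at h
    rw [hes]
    linarith

theorem deltaMax_le : deltaMax ≤ 0.12 := by
  have h : Lmax ^ 10 = (muC * aMax) ^ 5 := by
    rw [Lmax, show 10 = 2 * 5 by norm_num, pow_mul, Real.sq_sqrt (by norm_num [muC, aMax])]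
  rw [deltaMax, deltaFun, h]
  norm_num [muC, aMax, aM, rhoC]

theorem sqrt_coplanar_bounds {Γ : ℝ} (hΓ : Γ ∈ Set.Icc (-0.01 : ℝ) 0.495) :
    0.19 ≤ √((1 - 2*Γ) * (3 + 2*Γ)) ∧ √((1 - 2*Γ) * (3 + 2*Γ)) ≤ 2 := by
  obtain ⟨h1, h2⟩ := hΓ
  constructor
  · apply Real.le_sqrt_of_sq_le
    nlinarith
  · rw [Real.sqrt_le_left (by norm_num)]
    nlinarith

theorem coplanar_product_pos {Γ : ℝ} (hΓ : Γ ∈ Set.Icc (-0.01 : ℝ) 0.495) :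
    0 < (1 - 2*Γ) * (3 + 2*Γ) :=
  mul_pos (by linarith [hΓ.2]) (by linarith [hΓ.1])

theorem hasDerivAt_HCPhat_fst {Γ : ℝ} (hΓ : Γ ∈ Set.Icc (-0.01 : ℝ) 0.495) (h δ : ℝ) :
    HasDerivAt (fun z => HCPhat z h δ) (12 * Fh Γ h δ) Γ := by
  have hp := coplanar_product_pos hΓ
  have hid := hasDerivAt_id' Γ
  have hA : HasDerivAt (fun z : ℝ => 1 - 2*z) (-(2*1)) Γ := (hid.const_mul 2).const_sub 1
  have hB : HasDerivAt (fun z : ℝ => 3 + 2*z) (2*1) Γ := (hid.const_mul 2).const_add 3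
  have hS : HasDerivAt (fun z => √((1 - 2*z) * (3 + 2*z))) _ Γ := (hA.fun_mul hB).sqrt hp.ne'
  have hC := ((hid.const_mul 2).add_const 1).const_mul (2 * δ * U10)
  have hQ := (((hid.const_mul 12).const_sub 1).sub ((hid.pow 2).const_mul 12)).mul_const
    (1 + δ * U00 / 2)
  have hK := ((hA.const_mul (δ * U20 / 2)).mul hB).mul_const (Real.cos (2*h))
  refine ((hQ.sub ((hC.mul hS).mul_const (Real.cos h))).sub hK).congr_deriv ?_
  have hs : √((1 - 2*Γ) * (3 + 2*Γ)) ≠ 0 := (Real.sqrt_pos.2 hp).ne'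
  have hs2 := Real.sq_sqrt hp.le
  rw [Fh]
  set s := √((1 - 2*Γ) * (3 + 2*Γ))
  field_simp
  rw [hs2]
  push_cast
  ring

theorem hasDerivAt_HCPhat_snd (Γ h δ : ℝ) :
    HasDerivAt (fun y => HCPhat Γ y δ) (-12 * FΓ Γ h δ) h := by
  have hc := (Real.hasDerivAt_cos h).const_mul
    (2 * δ * U10 * (2*Γ + 1) * √((1 - 2*Γ) * (3 + 2*Γ)))
  have h2 := (((hasDerivAt_id' h).const_mul 2).cos).const_mul
    ((δ * U20 / 2) * (1 - 2*Γ) * (3 + 2*Γ))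
  refine ((hc.const_sub ((1 - 12*Γ - 12*Γ^2) * (1 + δ * U00 / 2))).sub h2).congr_deriv ?_
  rw [FΓ]
  ring

theorem Fh_neg {Γ δ : ℝ} (hΓ : Γ ∈ Set.Icc (-0.01 : ℝ) 0.495) (hδ : δ ∈ Set.Ioc (0 : ℝ) 0.12)
    (h : ℝ) : Fh Γ h δ < 0 := by
  obtain ⟨hs, -⟩ := sqrt_coplanar_bounds hΓ
  obtain ⟨hΓ1, hΓ2⟩ := hΓ
  obtain ⟨hδ0, hδ1⟩ := hδ
  have hq : |1 - 4*Γ - 4*Γ^2| ≤ 2 := abs_le.2 ⟨by nlinarith, by nlinarith⟩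
  have hmid : |(2*δ/3) * U10 * (1 - 4*Γ - 4*Γ^2) / √((1 - 2*Γ) * (3 + 2*Γ)) * Real.cos h|
      ≤ 0.5 := by
    have hU : (0 : ℝ) < U10 := by norm_num [U10]
    rw [abs_mul, abs_div, abs_mul, abs_of_pos (show 0 < 2*δ/3 * U10 by positivity),
      abs_of_pos (show 0 < √((1 - 2*Γ) * (3 + 2*Γ)) by linarith)]
    calc _ ≤ (2*0.12/3) * U10 * 2 / 0.19 * 1 := by
          gcongr
          exact Real.abs_cos_le_one h
      _ ≤ 0.5 := by norm_num [U10]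
  have hlast : (δ/6) * U20 * (1 + 2*Γ) * Real.cos (2*h) ≤ 0.01 := by
    have hU : (0 : ℝ) < U20 := by norm_num [U20]
    calc _ ≤ (δ/6) * U20 * (1 + 2*Γ) * 1 := by
          have : 0 ≤ 1 + 2*Γ := by linarith
          gcongr
          exact Real.cos_le_one _
      _ ≤ (0.12/6) * U20 * 2 * 1 := by
          gcongr
          · linarith
          · linarith
      _ ≤ 0.01 := by norm_num [U20]
  have hfirst : 0.98 ≤ (1 + 2*Γ) * (1 + δ * U00 / 2) := by
    have : (0 : ℝ) ≤ δ * U00 / 2 := by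
      have : (0 : ℝ) < U00 := by norm_num [U00]
      positivity
    nlinarith
  have := (abs_le.1 hmid).1
  rw [Fh]
  linarith

theorem strictAntiOn_HCPhat {δ : ℝ} (hδ : δ ∈ Set.Ioc (0 : ℝ) 0.12) (h : ℝ) :
    StrictAntiOn (fun z => HCPhat z h δ) (Set.Icc (-0.01 : ℝ) 0.495) := by
  refine strictAntiOn_of_deriv_neg (convex_Icc _ _)
    (fun z hz => (hasDerivAt_HCPhat_fst hz h δ).continuousAt.continuousWithinAt) fun z hz => ?_
  rw [interior_Icc] at hz
  rw [(hasDerivAt_HCPhat_fst (Set.Ioo_subset_Icc_self hz) h δ).deriv]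
  linarith [Fh_neg (Set.Ioo_subset_Icc_self hz) hδ h]

theorem contDiffAt_HCPhat {Γ : ℝ} (hΓ : Γ ∈ Set.Icc (-0.01 : ℝ) 0.495) (h δ : ℝ) :
    ContDiffAt ℝ 1 (fun p : ℝ × ℝ => HCPhat p.2 p.1 δ) (h, Γ) := by
  unfold HCPhat
  have := (coplanar_product_pos hΓ).ne'
  fun_prop (disch := assumption)

theorem HCPhat_zero_zero_le {δ : ℝ} (hδ : 0 ≤ δ) (h : ℝ) : HCPhat 0 0 δ ≤ HCPhat 0 h δ := by
  have hs : 1 ≤ √((1 - 2*0) * (3 + 2*0)) := by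
    apply Real.le_sqrt_of_sq_le
    norm_num
  simp only [HCPhat, Real.cos_two_mul, mul_zero, Real.cos_zero]
  simp only [mul_zero] at hs
  generalize √((1 - 0) * (3 + 0)) = s at hs ⊢
  have h1 := Real.cos_le_one h
  have h2 := Real.neg_one_le_cos h
  norm_num [U00, U10, U20]
  have : 0 ≤ δ * (1 - Real.cos h) := mul_nonneg hδ (by linarith)
  nlinarith [mul_nonneg this (sub_nonneg.2 hs), mul_nonneg this (sub_nonneg.2 h1)]

theorem HCPhat_le_pi {δ : ℝ} (hδ : 0 ≤ δ) (h : ℝ) : HCPhat 0.49 h δ ≤ HCPhat 0.49 π δ := by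
  have hs : 0.19 ≤ √((1 - 2*0.49) * (3 + 2*0.49)) :=
    (sqrt_coplanar_bounds (by constructor <;> norm_num)).1
  simp only [HCPhat, Real.cos_two_mul, Real.cos_pi]
  generalize √((1 - 2*0.49) * (3 + 2*0.49)) = s at hs ⊢
  have h1 := Real.cos_le_one h
  have h2 := Real.neg_one_le_cos h
  norm_num [U00, U10, U20]
  have : 0 ≤ δ * (1 + Real.cos h) := mul_nonneg hδ (by linarith)
  nlinarith [mul_nonneg this (sub_nonneg.2 hs), mul_nonneg this (sub_nonneg.2 h1)]

theorem HCPhat_pi_lt_zero_zero {δ : ℝ} (hδ : δ ∈ Set.Ioc (0 : ℝ) 0.12) :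
    HCPhat 0.49 π δ < HCPhat 0 0 δ := by
  have hs := sqrt_coplanar_bounds (Γ := 0.49) (by constructor <;> norm_num)
  have hs0 := sqrt_coplanar_bounds (Γ := 0) (by constructor <;> norm_num)
  obtain ⟨hδ0, hδ1⟩ := hδ
  simp only [HCPhat, Real.cos_two_mul, Real.cos_pi, mul_zero, Real.cos_zero]
  simp only [mul_zero] at hs0
  generalize √((1 - 2*0.49) * (3 + 2*0.49)) = s at hs ⊢
  generalize √((1 - 0) * (3 + 0)) = s₀ at hs0 ⊢
  norm_num [U00, U10, U20]
  nlinarith [mul_le_mul_of_nonneg_left hs.2 hδ0.le, mul_le_mul_of_nonneg_left hs0.2 hδ0.le]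

/-- Each energy level in the range is a graph `Γ̂ = g(ĥ)` of a periodic differentiable function. -/
theorem exists_level_graph {δ E : ℝ} (hδ : δ ∈ Set.Ioc (0 : ℝ) 0.12)
    (hE : E ∈ Set.Icc (HCPhat 0.49 π δ) (HCPhat 0 0 δ)) :
    ∃ g : ℝ → ℝ, Function.Periodic g (2 * π) ∧ (∀ h, g h ∈ Set.Icc (0 : ℝ) 0.49) ∧
      (∀ h, HCPhat (g h) h δ = E) ∧ ∀ h, HasDerivAt g (FΓ (g h) h δ / Fh (g h) h δ) h := by
  have hsub : Set.Icc (0 : ℝ) 0.49 ⊆ Set.Icc (-0.01) 0.495 :=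
    Set.Icc_subset_Icc (by norm_num) (by norm_num)
  have hex : ∀ h, ∃ z ∈ Set.Icc (0 : ℝ) 0.49, HCPhat z h δ = E := fun h =>
    intermediate_value_Icc' (f := fun z => HCPhat z h δ) (by norm_num)
      (fun z hz => (hasDerivAt_HCPhat_fst (hsub hz) h δ).continuousAt.continuousWithinAt)
      ⟨(HCPhat_le_pi hδ.1.le h).trans hE.1, hE.2.trans (HCPhat_zero_zero_le hδ.1.le h)⟩
  choose g hg hgE using hex
  refine ⟨g, fun h => ?_, hg, hgE, fun h => ?_⟩
  · apply (strictAntiOn_HCPhat hδ h).injOn (hsub (hg _)) (hsub (hg _))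
    have hp : HCPhat (g (h + 2 * π)) h δ = HCPhat (g (h + 2 * π)) (h + 2 * π) δ := by
      simp only [HCPhat, Real.cos_add_two_pi]
      rw [show 2 * (h + 2 * π) = 2 * h + 2 * π + 2 * π by ring]
      simp only [Real.cos_add_two_pi]
    exact hp.trans ((hgE _).trans (hgE h).symm)
  · have dH := (contDiffAt_HCPhat (hsub (hg h)) h δ).hasStrictFDerivAt one_ne_zero
    set H' := fderiv ℝ (fun p : ℝ × ℝ => HCPhat p.2 p.1 δ) (h, g h)
    have h01 : H' (0, 1) = 12 * Fh (g h) h δ :=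
      (HasFDerivAt.comp_hasDerivAt (g h) dH.hasFDerivAt
        ((hasDerivAt_const (g h) h).prodMk (hasDerivAt_id (g h)))).unique
        (hasDerivAt_HCPhat_fst (hsub (hg h)) h δ)
    have h10 : H' (1, 0) = -12 * FΓ (g h) h δ :=
      (HasFDerivAt.comp_hasDerivAt (f := fun y => (y, g h)) h dH.hasFDerivAt
        ((hasDerivAt_id' h).prodMk (hasDerivAt_const h (g h)))).unique
        (hasDerivAt_HCPhat_snd (g h) h δ)
    have hF := (Fh_neg (hsub (hg h)) hδ h).ne
    have hU : Set.Icc (-0.01 : ℝ) 0.495 ∈ nhds (g h) :=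
      Icc_mem_nhds (by linarith [(hg h).1]) (by linarith [(hg h).2])
    convert hasDerivAt_of_levelSet hU (fun y => (strictAntiOn_HCPhat hδ y).injOn)
      (fun y => hsub (hg y)) hgE dH (by rw [h01]; exact mul_ne_zero (by norm_num) hF) using 1
    rw [h01, h10]
    field_simp

/-- for `δ ∈ (0,δ_max]`, `Ê_min(δ) < Ê_max(δ)` and every energy level
`Ê ∈ [Ê_min, Ê_max]` carries a periodic orbit of the rescaled coplanar system which is
`2π`-decreasing in `ĥ` and stays in `Γ̂ ∈ [0,0.49]`. -/
theorem stmt11 :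
    ∀ δ ∈ Set.Ioc (0:ℝ) deltaMax,
      HCPhat 0.49 π δ < HCPhat 0 0 δ ∧
      ∀ E ∈ Set.Icc (HCPhat 0.49 π δ) (HCPhat 0 0 δ),
        ∃ T > (0:ℝ), ∃ Γh hh : ℝ → ℝ,
          SolvesCP Γh hh δ ∧
          hh 0 = 0 ∧
          (∀ t : ℝ, Γh t ∈ Set.Icc (0:ℝ) 0.49) ∧
          (∀ t : ℝ, HCPhat (Γh t) (hh t) δ = E) ∧
          (∀ t : ℝ, Γh (t + T) = Γh t ∧ hh (t + T) = hh t - 2 * π) := by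
  intro δ hδ
  have hδ' : δ ∈ Set.Ioc (0 : ℝ) 0.12 := ⟨hδ.1, hδ.2.trans deltaMax_le⟩
  refine ⟨HCPhat_pi_lt_zero_zero hδ', fun E hE => ?_⟩
  obtain ⟨g, hper, hg, hgE, hgd⟩ := exists_level_graph hδ' hE
  have hg' : ∀ h, g h ∈ Set.Icc (-0.01 : ℝ) 0.495 := fun h =>
    Set.Icc_subset_Icc (by norm_num) (by norm_num) (hg h)
  have hneg : ∀ h, Fh (g h) h δ < 0 := fun h => Fh_neg (hg' h) hδ' h
  have hgc : Continuous g := continuous_iff_continuousAt.2 fun h => (hgd h).continuousAt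
  have hs : ∀ h, √((1 - 2 * g h) * (3 + 2 * g h)) ≠ 0 := fun h =>
    (Real.sqrt_pos.2 (coplanar_product_pos (hg' h))).ne'
  have hFc : Continuous fun h => Fh (g h) h δ := by
    unfold Fh
    fun_prop (disch := assumption)
  have hFper : Function.Periodic (fun h => Fh (g h) h δ) (2 * π) := fun h => by
    simp only [Fh, hper h, Real.cos_add_two_pi]
    rw [show 2 * (h + 2 * π) = 2 * h + 2 * π + 2 * π by ring]
    simp only [Real.cos_add_two_pi]
  obtain ⟨T, hT, θ, hθ0, hθ, hθT⟩ :=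
    exists_solution_of_periodic_neg hFc hneg hFper Real.two_pi_pos
  refine ⟨T, hT, g ∘ θ, θ, fun t => ⟨?_, hθ t⟩, hθ0, fun t => hg _, fun t => hgE _,
    fun t => ⟨?_, hθT t⟩⟩
  · have := (hgd (θ t)).comp t (hθ t)
    rwa [div_mul_cancel₀ _ (hneg _).ne] at this
  · simp only [Function.comp_apply, hθT t, hper.sub_eq]

end Secular
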